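/- For any 0/1 matrix A, mim(A^{⊗2}) ≥ him(A). -/

import Mathlib

open Filter

section Defs

variable {I J K L : Type*}

/-- The matrix `M` has an `m × m` identity submatrix after permutation
(an induced matching of size `m`). -/
def HasMim (M : I → J → Prop) (m : ℕ) : Prop :=
  ∃ (r : Fin m → I) (c : Fin m → J), Function.Injective r ∧ Function.Injective c ∧
    ∀ i j, M (r i) (c j) ↔ i = j

/-- `mim M` is the largest `m` such that `M` has an `m × m` identity submatrix
after permutation. -/
noncomputable def mim (M : I → J → Prop) : ℕ := sSup {m | HasMim M m}

/-- The matrix `M` has a half-induced matching of size `m`. -/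
def HasHim (M : I → J → Prop) (m : ℕ) : Prop :=
  ∃ (r : Fin m → I) (c : Fin m → J), Function.Injective r ∧ Function.Injective c ∧
    (∀ i, M (r i) (c i)) ∧ ∀ i j : Fin m, i < j → ¬ M (r i) (c j)

/-- `him M` is the largest `m` such that `M` has a half-induced matching of size `m`. -/
noncomputable def him (M : I → J → Prop) : ℕ := sSup {m | HasHim M m}

/-- Kronecker product of two 0/1 (`Prop`-valued) matrices. -/
def kron (M : I → J → Prop) (N : K → L → Prop) : I × K → J × L → Prop :=
  fun p q => M p.1 q.1 ∧ N p.2 q.2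

/-- `k`-fold Kronecker power of a 0/1 (`Prop`-valued) matrix. -/
def kronPow (M : I → J → Prop) (k : ℕ) : (Fin k → I) → (Fin k → J) → Prop :=
  fun r c => ∀ t, M (r t) (c t)

/-- `mimsup M = limsup_{k → ∞} mim (M^{⊗ k}) ^ (1/k)`. -/
noncomputable def mimsup (M : I → J → Prop) : ℝ :=
  Filter.atTop.limsup fun k : ℕ => (mim (kronPow M k) : ℝ) ^ (1 / (k : ℝ))

/-- `𝒜'` is a subset of `𝒜` that `M`-represents `𝒜`. -/
def Represents (M : I → J → Prop) (𝒜 𝒜' : Set I) : Prop :=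
  𝒜' ⊆ 𝒜 ∧ ∀ j, (∃ i ∈ 𝒜, M i j) → ∃ i' ∈ 𝒜', M i' j

end Defs

theorem HasMim.le_card {I J : Type*} [Fintype I] {M : I → J → Prop} {k : ℕ}
    (h : HasMim M k) : k ≤ Fintype.card I := by
  obtain ⟨r, -, hr, -⟩ := h
  simpa using Fintype.card_le_of_injective r hr

theorem HasHim.le_card {I J : Type*} [Fintype I] {M : I → J → Prop} {k : ℕ}
    (h : HasHim M k) : k ≤ Fintype.card I := by
  obtain ⟨r, -, hr, -⟩ := h
  simpa using Fintype.card_le_of_injective r hr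

/-- Pairing a half-induced matching with its reversal gives an induced matching
of the Kronecker square. -/
theorem HasHim.hasMim_kron_self {I J : Type*} {M : I → J → Prop} {k : ℕ}
    (h : HasHim M k) : HasMim (kron M M) k := by
  obtain ⟨r, c, hr, hc, hdiag, hlt⟩ := h
  refine ⟨fun i => (r i, r i.rev), fun i => (c i, c i.rev),
    fun i j hij => hr (congrArg Prod.fst hij), fun i j hij => hc (congrArg Prod.fst hij),
    fun i j => ⟨fun hij => ?_, ?_⟩⟩
  · rcases lt_trichotomy i j with h | h | h
    · exact absurd hij.1 (hlt i j h)
    · exact h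
    · exact absurd hij.2 (hlt i.rev j.rev (Fin.rev_lt_rev.mpr h))
  · rintro rfl
    exact ⟨hdiag i, hdiag i.rev⟩

theorem stmt8 {n m : ℕ} (A : Fin n → Fin m → Prop) :
    him A ≤ mim (kron A A) := by
  have hne : {k | HasHim A k}.Nonempty :=
    ⟨0, Fin.elim0, Fin.elim0, fun i => i.elim0, fun i => i.elim0, fun i => i.elim0,
      fun i => i.elim0⟩
  have hmem : HasHim A (him A) := Nat.sSup_mem hne ⟨_, fun _ h => h.le_card⟩
  exact le_csSup ⟨_, fun _ h => HasMim.le_card h⟩ hmem.hasMim_kron_self
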